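/- arXiv:1612.03793 — 2 statements merged into one kernel-verified Lean document; each statement's English description precedes it below -/
import Mathlib

section
/- Let F = ℝ or ℂ and let M(λ) ∈ F[λ]^{m×(m+n)}_d be a polynomial matrix such that md ≤ n. Then: (a) M(λ) has full-Sylvester-rank if and only if S_1(M) has full row rank; (b) every M̃(λ) ∈ F[λ]^{m×(m+n)}_d with ‖S_1(M) − S_1(M̃)‖_2 < σ_{(d+1)m}(S_1(M)) has full-Sylvester-rank; (c) there exists M̃(λ) ∈ F[λ]^{m×(m+n)}_d that does not have full-Sylvester-rank and satisfies ‖S_1(M) − S_1(M̃)‖_2 = σ_{(d+1)m}(S_1(M)); in particular, the robustness radius in (b) is sharp. -/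
open Polynomial Matrix

noncomputable section

variable {F : Type*} [Field F]

/-- The rows of a polynomial matrix, viewed as vectors of rational functions. -/
def ratRow {p q : ℕ} (M : Matrix (Fin p) (Fin q) F[X]) (i : Fin p) :
    Fin q → RatFunc F :=
  fun j => algebraMap F[X] (RatFunc F) (M i j)

/-- The rational vector subspace spanned by the rows of a polynomial matrix. -/
def rowSpan {p q : ℕ} (M : Matrix (Fin p) (Fin q) F[X]) :
    Submodule (RatFunc F) (Fin q → RatFunc F) :=
  Submodule.span (RatFunc F) (Set.range (ratRow M))

/-- The degree of the `i`-th row of a polynomial matrix. -/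
def rowDeg {p q : ℕ} (M : Matrix (Fin p) (Fin q) F[X]) (i : Fin p) : ℕ :=
  Finset.univ.sup fun j => (M i j).natDegree

/-- The rows of `M` form a polynomial basis of the rational subspace `V` whose sum of
row degrees is minimal among all polynomial bases of `V`. -/
def IsMinimalBasisOf {p q : ℕ} (V : Submodule (RatFunc F) (Fin q → RatFunc F))
    (M : Matrix (Fin p) (Fin q) F[X]) : Prop :=
  LinearIndependent (RatFunc F) (ratRow M) ∧ rowSpan M = V ∧
    ∀ M' : Matrix (Fin p) (Fin q) F[X],
      LinearIndependent (RatFunc F) (ratRow M') → rowSpan M' = V →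
        ∑ i, rowDeg M i ≤ ∑ i, rowDeg M' i

/-- A polynomial matrix is a minimal basis if its rows form a minimal basis of the
rational subspace they span. -/
def IsMinimalBasis {p q : ℕ} (M : Matrix (Fin p) (Fin q) F[X]) : Prop :=
  IsMinimalBasisOf (rowSpan M) M

/-- A polynomial matrix viewed as a matrix of rational functions. -/
def ratMat {p q : ℕ} (M : Matrix (Fin p) (Fin q) F[X]) :
    Matrix (Fin p) (Fin q) (RatFunc F) :=
  M.map (algebraMap F[X] (RatFunc F))

/-- The right null-space over `F(λ)` of a polynomial matrix. -/
def rightNullSpace {p q : ℕ} (M : Matrix (Fin p) (Fin q) F[X]) :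
    Submodule (RatFunc F) (Fin q → RatFunc F) :=
  LinearMap.ker (Matrix.mulVecLin (ratMat M))

/-- The `k`-th Sylvester matrix of a polynomial matrix regarded as having degree at
most `e`: the block-Toeplitz matrix with `k` block columns whose `j`-th block column
carries the coefficients `M_0, …, M_e` in block rows `j, …, j+e` and zeros elsewhere. -/
def sylv {p q : ℕ} (e k : ℕ) (M : Matrix (Fin p) (Fin q) F[X]) :
    Matrix (Fin (k + e) × Fin p) (Fin k × Fin q) F :=
  fun r c =>
    if (c.1 : ℕ) ≤ (r.1 : ℕ) ∧ (r.1 : ℕ) ≤ (c.1 : ℕ) + e then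
      (M r.2 c.2).coeff ((r.1 : ℕ) - (c.1 : ℕ))
    else 0

/-- `M`, regarded as a polynomial matrix of degree at most `e`, has
full-Sylvester-rank if every Sylvester matrix `S_k`, `k ≥ 1`, has full rank. -/
def HasFullSylvesterRank {p q : ℕ} (e : ℕ) (M : Matrix (Fin p) (Fin q) F[X]) : Prop :=
  ∀ k : ℕ, 1 ≤ k → (sylv e k M).rank = min ((k + e) * p) (k * q)

/-- The `k`-th coefficient matrix of a polynomial matrix. -/
def coeffMat {p q : ℕ} (k : ℕ) (M : Matrix (Fin p) (Fin q) F[X]) :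
    Matrix (Fin p) (Fin q) F :=
  fun i j => (M i j).coeff k

/-- The highest-row-degree coefficient matrix: its `i`-th row is the coefficient of
`λ^{d_i}` in the `i`-th row of `M`, where `d_i` is the `i`-th row degree. -/
def highRowMat {p q : ℕ} (M : Matrix (Fin p) (Fin q) F[X]) :
    Matrix (Fin p) (Fin q) F :=
  fun i j => (M i j).coeff (rowDeg M i)

/-- The `e`-reversal of a polynomial matrix: `rev_e P(λ) = λ^e P(1/λ)`. -/
def revMat {p q : ℕ} (e : ℕ) (P : Matrix (Fin p) (Fin q) F[X]) :
    Matrix (Fin p) (Fin q) F[X] :=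
  fun i j => (P i j).reflect e


variable {𝕜 : Type*} [RCLike 𝕜]

/-- The spectral norm (largest singular value) of a matrix. -/
def sNorm {a b : Type*} [Fintype a] [Fintype b] [DecidableEq b]
    (A : Matrix a b 𝕜) : ℝ :=
  ‖LinearMap.toContinuousLinearMap (Matrix.toEuclideanLin A)‖

/-- The Frobenius norm of a matrix. -/
def fNorm {a b : Type*} [Fintype a] [Fintype b] (A : Matrix a b 𝕜) : ℝ :=
  Real.sqrt (∑ i, ∑ j, ‖A i j‖ ^ 2)

/-- The `j`-th largest singular value of a matrix (`j = 1, 2, …`), via the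
Courant–Fischer variational characterization. -/
def singVal {a b : Type*} [Fintype a] [Fintype b] [DecidableEq b]
    (A : Matrix a b 𝕜) (j : ℕ) : ℝ :=
  sSup {r : ℝ | ∃ V : Submodule 𝕜 (EuclideanSpace 𝕜 b),
    Module.finrank 𝕜 V = j ∧ ∀ x ∈ V, r * ‖x‖ ≤ ‖Matrix.toEuclideanLin A x‖}


section LinearMaps

variable {E G : Type*} [NormedAddCommGroup E] [InnerProductSpace 𝕜 E] [FiniteDimensional 𝕜 E]
  [NormedAddCommGroup G] [InnerProductSpace 𝕜 G]

/-- A linear map with trivial kernel on a subspace of the dimension of its codomain maps that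
subspace onto the codomain. -/
lemma exists_mem_apply_eq_of_finrank_eq [FiniteDimensional 𝕜 G] (T : E →ₗ[𝕜] G) (V : Submodule 𝕜 E)
    (hV : Module.finrank 𝕜 V = Module.finrank 𝕜 G) (hT : ∀ x ∈ V, T x = 0 → x = 0) (y : G) :
    ∃ x ∈ V, T x = y := by
  have hinj : Function.Injective (T.domRestrict V) := by
    refine (injective_iff_map_eq_zero _).2 fun x hx => ?_
    exact Subtype.ext (hT x x.2 hx)
  obtain ⟨x, hx⟩ := (LinearMap.injective_iff_surjective_of_finrank_eq_finrank hV).1 hinj y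
  exact ⟨x, x.2, hx⟩

/-- The norm of a linear map attains its minimum on the unit sphere. -/
lemma exists_unit_minimizer [Nontrivial E] (S : E →ₗ[𝕜] G) :
    ∃ u : E, ‖u‖ = 1 ∧ ∀ y, ‖S u‖ * ‖y‖ ≤ ‖S y‖ := by
  have : ProperSpace E := FiniteDimensional.proper_rclike 𝕜 E
  obtain ⟨v, hv⟩ := exists_ne (0 : E)
  have hne : (Metric.sphere (0 : E) 1).Nonempty :=
    ⟨((‖v‖⁻¹ : ℝ) : 𝕜) • v, by simp [norm_smul, hv]⟩
  obtain ⟨u, hu, hmin⟩ := (isCompact_sphere (0 : E) 1).exists_isMinOn hne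
    (LinearMap.continuous_of_finiteDimensional S).norm.continuousOn
  refine ⟨u, by simpa using hu, fun y => ?_⟩
  rcases eq_or_ne y 0 with rfl | hy
  · simp
  have hy' : 0 < ‖y‖ := norm_pos_iff.2 hy
  have h := hmin (show ((‖y‖⁻¹ : ℝ) : 𝕜) • y ∈ Metric.sphere (0 : E) 1 by simp [norm_smul, hy])
  simp only [Set.mem_ofPred_eq, map_smul, norm_smul, RCLike.norm_ofReal, abs_inv, abs_norm] at h
  rwa [inv_mul_eq_div, le_div_iff₀ hy'] at h

lemma exists_submodule_finrank_eq {j : ℕ} (hj : j ≤ Module.finrank 𝕜 E) :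
    ∃ V : Submodule 𝕜 E, Module.finrank 𝕜 V = j := by
  have b := Module.finBasis 𝕜 E
  refine ⟨Submodule.span 𝕜 (Set.range (b ∘ Fin.castLE hj)), ?_⟩
  simpa using finrank_span_eq_card (b.linearIndependent.comp _ (Fin.castLE_injective hj))

/-- The Courant–Fischer value of order `dim G` of `T : E → G` is the minimal norm of the adjoint
on the unit sphere. -/
lemma exists_unit_isGreatest_norm_adjoint [FiniteDimensional 𝕜 G] [Nontrivial G]
    (T : E →ₗ[𝕜] G) (hdim : Module.finrank 𝕜 G ≤ Module.finrank 𝕜 E) :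
    ∃ u : G, ‖u‖ = 1 ∧ IsGreatest {r : ℝ | ∃ V : Submodule 𝕜 E,
      Module.finrank 𝕜 V = Module.finrank 𝕜 G ∧ ∀ x ∈ V, r * ‖x‖ ≤ ‖T x‖}
        ‖LinearMap.adjoint T u‖ := by
  obtain ⟨u, hu, hmin⟩ := exists_unit_minimizer (LinearMap.adjoint T)
  refine ⟨u, hu, ?_, ?_⟩
  · rcases (norm_nonneg (LinearMap.adjoint T u)).eq_or_lt with h0 | hpos
    · obtain ⟨V, hV⟩ := exists_submodule_finrank_eq hdim
      exact ⟨V, hV, fun x _ => by simp [← h0]⟩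
    · refine ⟨LinearMap.range (LinearMap.adjoint T), LinearMap.finrank_range_of_inj ?_, ?_⟩
      · refine (injective_iff_map_eq_zero _).2 fun y hy => ?_
        have h := hmin y
        rw [hy, norm_zero] at h
        exact norm_le_zero_iff.1 (nonpos_of_mul_nonpos_right h hpos)
      · rintro _ ⟨y, rfl⟩
        set x := LinearMap.adjoint T y
        rcases eq_or_ne x 0 with hx | hx
        · simp [hx]
        have hx' : 0 < ‖x‖ := norm_pos_iff.2 hx
        have h1 : ‖x‖ * ‖x‖ ≤ ‖y‖ * ‖T x‖ := by
          rw [← inner_self_eq_norm_mul_norm (𝕜 := 𝕜), LinearMap.adjoint_inner_left]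
          exact re_inner_le_norm _ _
        have h2 := mul_le_mul_of_nonneg_right (hmin y) (norm_nonneg (T x))
        have h3 := mul_le_mul_of_nonneg_left h1 hpos.le
        refine le_of_mul_le_mul_left ?_ hx'
        linarith
  · rintro r ⟨V, hV, hr⟩
    rcases le_or_gt r 0 with h0 | hpos
    · exact h0.trans (norm_nonneg _)
    obtain ⟨x, hxV, hx⟩ := exists_mem_apply_eq_of_finrank_eq T V hV (fun x hx h => by
      have h' := hr x hx
      rw [h, norm_zero] at h'
      exact norm_le_zero_iff.1 (nonpos_of_mul_nonpos_right h' hpos)) u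
    have h1 : (1 : ℝ) ≤ ‖LinearMap.adjoint T u‖ * ‖x‖ := by
      calc (1 : ℝ) = RCLike.re (inner 𝕜 u u) := by rw [inner_self_eq_norm_mul_norm, hu, one_mul]
        _ = RCLike.re (inner 𝕜 (LinearMap.adjoint T u) x) := by
          rw [LinearMap.adjoint_inner_left, hx]
        _ ≤ _ := re_inner_le_norm _ _
    have h2 := hr x hxV
    rw [hx, hu] at h2
    calc r ≤ r * (‖LinearMap.adjoint T u‖ * ‖x‖) := le_mul_of_one_le_right hpos.le h1
      _ = ‖LinearMap.adjoint T u‖ * (r * ‖x‖) := by ring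
      _ ≤ _ := mul_le_of_le_one_right (norm_nonneg _) h2

end LinearMaps

section Matrices

variable {a b : Type*} [Fintype a] [Fintype b]

lemma rank_eq_card_iff_surjective_mulVec (A : Matrix a b F) :
    A.rank = Fintype.card a ↔ Function.Surjective A.mulVec := by
  rw [Matrix.rank, ← Module.finrank_fintype_fun_eq_card F (η := a), ← Matrix.coe_mulVecLin,
    ← LinearMap.range_eq_top]
  exact ⟨Submodule.eq_top_of_finrank_eq, fun h => by rw [h, finrank_top]⟩

variable [DecidableEq b]

lemma rank_eq_card_iff_surjective_toEuclideanLin (A : Matrix a b 𝕜) :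
    A.rank = Fintype.card a ↔ Function.Surjective (Matrix.toEuclideanLin A) := by
  rw [rank_eq_card_iff_surjective_mulVec]
  refine ⟨fun h y => ?_, fun h y => ?_⟩
  · obtain ⟨x, hx⟩ := h (WithLp.ofLp y)
    exact ⟨WithLp.toLp 2 x, by simp [Matrix.toLpLin_apply, hx]⟩
  · obtain ⟨x, hx⟩ := h (WithLp.toLp 2 y)
    exact ⟨WithLp.ofLp x, by simpa [Matrix.toLpLin_apply] using congrArg WithLp.ofLp hx⟩

lemma norm_toEuclideanLin_le (A : Matrix a b 𝕜) (x : EuclideanSpace 𝕜 b) :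
    ‖Matrix.toEuclideanLin A x‖ ≤ sNorm A * ‖x‖ :=
  (LinearMap.toContinuousLinearMap (Matrix.toEuclideanLin A)).le_opNorm x

/-- A perturbation smaller than the last singular value preserves full row rank. -/
lemma rank_eq_card_of_sNorm_sub_lt_singVal (A B : Matrix a b 𝕜)
    (hab : Fintype.card a ≤ Fintype.card b)
    (h : sNorm (A - B) < singVal A (Fintype.card a)) : B.rank = Fintype.card a := by
  rw [rank_eq_card_iff_surjective_toEuclideanLin]
  obtain ⟨V₀, hV₀⟩ := exists_submodule_finrank_eq (𝕜 := 𝕜) (E := EuclideanSpace 𝕜 b)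
    (hab.trans_eq finrank_euclideanSpace.symm)
  obtain ⟨r, ⟨V, hV, hr⟩, hlt⟩ := exists_lt_of_lt_csSup (by exact ⟨0, V₀, hV₀, fun x _ => by simp⟩) h
  intro y
  obtain ⟨x, -, hx⟩ := exists_mem_apply_eq_of_finrank_eq (Matrix.toEuclideanLin B) V
    (hV.trans finrank_euclideanSpace.symm) (fun x hx h0 => by
      by_contra hne
      have hpos : 0 < ‖x‖ := norm_pos_iff.2 hne
      have h1 := norm_toEuclideanLin_le (A - B) x
      rw [map_sub, LinearMap.sub_apply, h0, sub_zero] at h1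
      have h2 := hr x hx
      have h3 := mul_lt_mul_of_pos_right hlt hpos
      linarith) y
  exact ⟨x, hx⟩

/-- The last singular value of a wide matrix is attained as the distance to some matrix without
full row rank. -/
lemma exists_rank_ne_card_sNorm_sub_eq_singVal [Nonempty a] (A : Matrix a b 𝕜)
    (hab : Fintype.card a ≤ Fintype.card b) :
    ∃ B : Matrix a b 𝕜, B.rank ≠ Fintype.card a ∧
      sNorm (A - B) = singVal A (Fintype.card a) := by
  set T := Matrix.toEuclideanLin A with hT
  obtain ⟨u, hu, hgr⟩ := exists_unit_isGreatest_norm_adjoint T (by simpa using hab)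
  set P := InnerProductSpace.rankOne 𝕜 u (LinearMap.adjoint T u) with hP
  refine ⟨A - Matrix.toEuclideanLin.symm P.toLinearMap, ?_, ?_⟩
  · rw [ne_eq, rank_eq_card_iff_surjective_toEuclideanLin, map_sub, LinearEquiv.apply_symm_apply]
    intro hsurj
    obtain ⟨x, hx⟩ := hsurj u
    have h : inner 𝕜 u u = (0 : 𝕜) := by
      nth_rw 2 [← hx]
      rw [LinearMap.sub_apply, inner_sub_right, ContinuousLinearMap.coe_coe, hP,
        InnerProductSpace.inner_right_rankOne_apply, inner_self_eq_norm_sq_to_K, hu,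
        LinearMap.adjoint_inner_left]
      simp [hT]
    rw [inner_self_eq_zero] at h
    simp [h] at hu
  · have hσ : singVal A (Fintype.card a) = ‖LinearMap.adjoint T u‖ := by
      rw [← hgr.csSup_eq, singVal, finrank_euclideanSpace]
    rw [hσ, sub_sub_cancel, sNorm, LinearEquiv.apply_symm_apply]
    change ‖P‖ = _
    rw [hP, InnerProductSpace.norm_rankOne, hu, one_mul]

end Matrices

section Sylvester

variable {p q : ℕ}

/-- If `S_1(M)` has full row rank, then so does every `S_k(M)` with `k ≥ 1`. -/
lemma rank_sylv_of_rank_sylv_one {d k : ℕ} (hk : 1 ≤ k) (M : Matrix (Fin p) (Fin q) F[X])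
    (h : (sylv d 1 M).rank = (1 + d) * p) : (sylv d k M).rank = (k + d) * p := by
  have hcard (l : ℕ) : Fintype.card (Fin (l + d) × Fin p) = (l + d) * p := by simp
  rw [← hcard, rank_eq_card_iff_surjective_mulVec] at h ⊢
  rw [Matrix.mulVec_surjective_iff_exists_right_inverse] at h ⊢
  obtain ⟨B, hB⟩ := h
  have hlt (r : Fin (k + d)) : min (r : ℕ) (k - 1) < k := by omega
  have hlt' (r : Fin (k + d)) : (r : ℕ) - min (r : ℕ) (k - 1) < 1 + d := by omega
  refine ⟨Matrix.of fun c r => if (c.1 : ℕ) = min (r.1 : ℕ) (k - 1) then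
    B (0, c.2) (⟨r.1 - min (r.1 : ℕ) (k - 1), hlt' r.1⟩, r.2) else 0, ?_⟩
  ext ⟨r, i⟩ ⟨r', i'⟩
  rw [Matrix.mul_apply, Fintype.sum_prod_type, Finset.sum_eq_single ⟨_, hlt r'⟩]
  · simp only [sylv, Matrix.of_apply, if_true]
    by_cases hr : min (r' : ℕ) (k - 1) ≤ r ∧ (r : ℕ) ≤ min (r' : ℕ) (k - 1) + d
    · have hs : (r : ℕ) - min (r' : ℕ) (k - 1) < 1 + d := by omega
      have h1 := congrFun (congrFun hB (⟨_, hs⟩, i)) (⟨_, hlt' r'⟩, i')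
      rw [Matrix.mul_apply, Fintype.sum_prod_type, Fin.sum_univ_one] at h1
      have hs' : (r : ℕ) - min (r' : ℕ) (k - 1) ≤ d := by omega
      simp only [sylv, Fin.val_zero, Nat.zero_le, zero_add, hs', and_self, if_true,
        Nat.sub_zero] at h1
      simp only [hr, and_self, if_true, h1, Matrix.one_apply, Prod.mk.injEq, Fin.ext_iff]
      congr 2
      simp only [eq_iff_iff]
      omega
    · simp only [hr, if_false, zero_mul, Finset.sum_const_zero]
      rw [Matrix.one_apply_ne]
      rintro ⟨⟩
      omega
  · intro j _ hj
    have hj' : (j : ℕ) ≠ min (r' : ℕ) (k - 1) := fun h => hj (Fin.ext h)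
    simp [hj']
  · simp

/-- For `(1 + d) p ≤ q`, full-Sylvester-rank is equivalent to full row rank of `S_1`. -/
lemma hasFullSylvesterRank_iff_rank_sylv_one {d : ℕ} (hpq : (1 + d) * p ≤ q)
    (M : Matrix (Fin p) (Fin q) F[X]) :
    HasFullSylvesterRank d M ↔ (sylv d 1 M).rank = (1 + d) * p := by
  refine ⟨fun h => by rw [h 1 le_rfl, one_mul, min_eq_left hpq], fun h k hk => ?_⟩
  rw [rank_sylv_of_rank_sylv_one hk M h, min_eq_left]
  calc (k + d) * p ≤ (k * (1 + d)) * p := Nat.mul_le_mul_right p (by nlinarith)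
    _ = k * ((1 + d) * p) := mul_assoc _ _ _
    _ ≤ k * q := Nat.mul_le_mul_left k hpq

/-- Every matrix of the right size is the first Sylvester matrix of a polynomial matrix. -/
lemma exists_sylv_one_eq {d : ℕ} (A : Matrix (Fin (1 + d) × Fin p) (Fin 1 × Fin q) F) :
    ∃ M : Matrix (Fin p) (Fin q) F[X], (∀ i j, (M i j).natDegree ≤ d) ∧ sylv d 1 M = A := by
  refine ⟨fun i j => ∑ s : Fin (1 + d), Polynomial.monomial (s : ℕ) (A (s, i) (0, j)),
    fun i j => ?_, ?_⟩
  · refine Polynomial.natDegree_sum_le_of_forall_le _ _ fun s _ => ?_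
    exact (Polynomial.natDegree_monomial_le _).trans (by omega)
  · ext ⟨r, i⟩ ⟨c, j⟩
    have hr : (r : ℕ) ≤ d := by omega
    rw [Subsingleton.elim c 0]
    simp [sylv, hr, Polynomial.coeff_monomial, ← Fin.ext_iff]

end Sylvester

/-- Sharp robustness radius for "flat" polynomial matrices (`md ≤ n`):
(a) `M(λ)` has full-Sylvester-rank iff `S_1(M)` has full row rank; (b) every `M̃` of
degree at most `d` with `‖S_1(M) - S_1(M̃)‖_2 < σ_{(d+1)m}(S_1(M))` has
full-Sylvester-rank; (c) there is an `M̃` without full-Sylvester-rank at distance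
exactly `σ_{(d+1)m}(S_1(M))`. -/
theorem sharp_robustness_flat {𝕜 : Type*} [RCLike 𝕜] {m n d : ℕ}
    (hm : 0 < m) (hn : 0 < n) (hd : 0 < d)
    (M : Matrix (Fin m) (Fin (m + n)) 𝕜[X]) (hdeg : ∀ i j, (M i j).natDegree ≤ d)
    (hmd : m * d ≤ n) :
    (HasFullSylvesterRank d M ↔ (sylv d 1 M).rank = (1 + d) * m) ∧
    (∀ M' : Matrix (Fin m) (Fin (m + n)) 𝕜[X], (∀ i j, (M' i j).natDegree ≤ d) →
      sNorm (sylv d 1 M - sylv d 1 M') < singVal (sylv d 1 M) ((d + 1) * m) →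
      HasFullSylvesterRank d M') ∧
    (∃ M' : Matrix (Fin m) (Fin (m + n)) 𝕜[X],
      (∀ i j, (M' i j).natDegree ≤ d) ∧ ¬ HasFullSylvesterRank d M' ∧
      sNorm (sylv d 1 M - sylv d 1 M') = singVal (sylv d 1 M) ((d + 1) * m)) := by
  have hpq : (1 + d) * m ≤ m + n := by linarith [mul_comm m d, add_mul 1 d m]
  have hcard : Fintype.card (Fin (1 + d) × Fin m) = (1 + d) * m := by simp
  have hle : Fintype.card (Fin (1 + d) × Fin m) ≤ Fintype.card (Fin 1 × Fin (m + n)) := by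
    simpa using hpq
  have : NeZero m := ⟨hm.ne'⟩
  rw [add_comm d 1]
  refine ⟨hasFullSylvesterRank_iff_rank_sylv_one hpq M, fun M' _ h => ?_, ?_⟩
  · rw [hasFullSylvesterRank_iff_rank_sylv_one hpq, ← hcard]
    rw [← hcard] at h
    exact rank_eq_card_of_sNorm_sub_lt_singVal _ _ hle h
  · obtain ⟨B, hB, hσ⟩ := exists_rank_ne_card_sNorm_sub_eq_singVal (sylv d 1 M) hle
    obtain ⟨M', hM', rfl⟩ := exists_sylv_one_eq B
    rw [hcard] at hB hσ
    exact ⟨M', hM', by rwa [hasFullSylvesterRank_iff_rank_sylv_one hpq], hσ⟩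

end
end

section
/- Let F = ℝ or ℂ, let M(λ) ∈ F[λ]^{m×(m+n)}_d have full-Sylvester-rank, let k' = ⌈md/n⌉ and t = nk' − md, and let N(λ) ∈ F[λ]^{n×(m+n)}_{k'} be a minimal basis dual to M(λ). Define the reversals rev_d M(λ) = λ^d M(1/λ) and rev_{k'} N(λ) = λ^{k'} N(1/λ). If t = 0, then rev_d M(λ) and rev_{k'} N(λ) are dual minimal bases and both have full-Sylvester-rank. -/
open Polynomial Matrix

noncomputable section

variable {F : Type*} [Field F]

variable {𝕜 : Type*} [RCLike 𝕜]

section FullSylvesterRank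

variable {p q e k : ℕ}

/-- The vector of polynomials of degree less than `k` with prescribed coefficients. -/
def polyVec (c : Fin k × Fin q → F) : Fin q → F[X] :=
  fun j => ∑ l : Fin k, C (c (l, j)) * X ^ (l : ℕ)

theorem coeff_polyVec (c : Fin k × Fin q → F) (l : Fin k) (j : Fin q) :
    (polyVec c j).coeff l = c (l, j) := by
  simp [polyVec, coeff_X_pow, Fin.val_inj]

theorem degree_polyVec_lt (c : Fin k × Fin q → F) (j : Fin q) :
    (polyVec c j).degree < k := by
  rw [← mem_degreeLT]
  refine Submodule.sum_mem _ fun l _ => mem_degreeLT.2 ?_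
  exact (degree_C_mul_X_pow_le _ _).trans_lt (by exact_mod_cast l.2)

theorem polyVec_coeff {v : Fin q → F[X]} (hv : ∀ j, (v j).degree < k) :
    polyVec (fun c : Fin k × Fin q => (v c.2).coeff c.1) = v := by
  funext j
  ext l
  by_cases hl : l < k
  · exact coeff_polyVec _ ⟨l, hl⟩ j
  · have hkl : (k : WithBot ℕ) ≤ l := by exact_mod_cast not_lt.1 hl
    rw [coeff_eq_zero_of_degree_lt ((degree_polyVec_lt _ j).trans_le hkl),
      coeff_eq_zero_of_degree_lt ((hv j).trans_le hkl)]

theorem sylv_mulVec {P : Matrix (Fin p) (Fin q) F[X]} (hP : ∀ i j, (P i j).natDegree ≤ e)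
    (c : Fin k × Fin q → F) (r : Fin (k + e) × Fin p) :
    (sylv e k P *ᵥ c) r = ((P *ᵥ polyVec c) r.2).coeff r.1 := by
  simp only [mulVec, dotProduct, polyVec, finsetSum_coeff, Finset.mul_sum,
    Fintype.sum_prod_type_right]
  refine Finset.sum_congr rfl fun j _ => Finset.sum_congr rfl fun l _ => ?_
  rw [mul_left_comm, coeff_C_mul, coeff_mul_X_pow', mul_comm]
  congr 1
  simp only [sylv]
  by_cases hl : (l : ℕ) ≤ r.1
  · by_cases hr : (r.1 : ℕ) ≤ l + e
    · simp [hl, hr]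
    · rw [if_neg (fun h => hr h.2), if_pos hl, coeff_eq_zero_of_natDegree_lt]
      have := hP r.2 j
      omega
  · simp [hl]

theorem degree_mulVec_lt {P : Matrix (Fin p) (Fin q) F[X]} (hP : ∀ i j, (P i j).natDegree ≤ e)
    {v : Fin q → F[X]} (hv : ∀ j, (v j).degree < k) (i : Fin p) :
    ((P *ᵥ v) i).degree < (k + e : ℕ) := by
  rw [mulVec, dotProduct, ← mem_degreeLT]
  refine Submodule.sum_mem _ fun j _ => mem_degreeLT.2 ?_
  have h : (P i j).degree ≤ e := natDegree_le_iff_degree_le.1 (hP i j)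
  rw [degree_mul, add_comm k e]
  push_cast
  exact (add_le_add_left h _).trans_lt
    (WithBot.add_lt_add_left (WithBot.natCast_ne_bot e) (hv j))

theorem sylv_mulVecLin_injective_iff {P : Matrix (Fin p) (Fin q) F[X]}
    (hP : ∀ i j, (P i j).natDegree ≤ e) :
    Function.Injective (sylv e k P).mulVecLin ↔
      ∀ v : Fin q → F[X], (∀ j, (v j).degree < k) → P *ᵥ v = 0 → v = 0 := by
  rw [injective_iff_map_eq_zero]
  constructor
  · intro h v hv hPv
    have hc := h (fun c => (v c.2).coeff c.1) (by
      funext r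
      rw [mulVecLin_apply, sylv_mulVec hP, polyVec_coeff hv, hPv]
      simp)
    rw [← polyVec_coeff hv, hc]
    funext j
    simp [polyVec]
  · intro h c hc
    have hv := h (polyVec c) (degree_polyVec_lt c) (by
      funext i
      ext l
      by_cases hl : l < k + e
      · have := congrFun hc (⟨l, hl⟩, i)
        rwa [mulVecLin_apply, sylv_mulVec hP] at this
      · exact coeff_eq_zero_of_degree_lt ((degree_mulVec_lt hP (degree_polyVec_lt c) i).trans_le
          (by exact_mod_cast not_lt.1 hl)))
    funext r
    rw [← coeff_polyVec c r.1 r.2, hv]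
    simp

theorem sylv_mulVecLin_surjective_iff {P : Matrix (Fin p) (Fin q) F[X]}
    (hP : ∀ i j, (P i j).natDegree ≤ e) :
    Function.Surjective (sylv e k P).mulVecLin ↔
      ∀ w : Fin p → F[X], (∀ i, (w i).degree < (k + e : ℕ)) →
        ∃ v : Fin q → F[X], (∀ j, (v j).degree < k) ∧ P *ᵥ v = w := by
  constructor
  · intro h w hw
    obtain ⟨c, hc⟩ := h fun r => (w r.2).coeff r.1
    refine ⟨polyVec c, degree_polyVec_lt c, ?_⟩
    funext i
    ext l
    by_cases hl : l < k + e
    · have := congrFun hc (⟨l, hl⟩, i)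
      rwa [mulVecLin_apply, sylv_mulVec hP] at this
    · have h3 : ((k + e : ℕ) : WithBot ℕ) ≤ l := by exact_mod_cast not_lt.1 hl
      rw [coeff_eq_zero_of_degree_lt ((hw i).trans_le h3)]
      exact coeff_eq_zero_of_degree_lt
        ((degree_mulVec_lt hP (degree_polyVec_lt c) i).trans_le h3)
  · intro h y
    obtain ⟨v, hv, hPv⟩ := h (polyVec y) (degree_polyVec_lt y)
    refine ⟨fun c => (v c.2).coeff c.1, ?_⟩
    funext r
    rw [mulVecLin_apply, sylv_mulVec hP, polyVec_coeff hv, hPv, coeff_polyVec]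

theorem rank_eq_card_width_iff {a b : Type*} [Fintype a] [Fintype b] (A : Matrix a b F) :
    A.rank = Fintype.card b ↔ Function.Injective A.mulVecLin := by
  have h := LinearMap.finrank_range_add_finrank_ker A.mulVecLin
  rw [Module.finrank_fintype_fun_eq_card] at h
  rw [← LinearMap.ker_eq_bot, ← Submodule.finrank_eq_zero (R := F), Matrix.rank]
  omega

theorem rank_eq_card_height_iff {a b : Type*} [Fintype a] [Fintype b] (A : Matrix a b F) :
    A.rank = Fintype.card a ↔ Function.Surjective A.mulVecLin := by
  rw [← LinearMap.range_eq_top, Matrix.rank]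
  constructor
  · intro h
    exact Submodule.eq_top_of_finrank_eq (by rw [h, Module.finrank_fintype_fun_eq_card])
  · intro h
    rw [h, finrank_top, Module.finrank_fintype_fun_eq_card]

/-- A basis all of whose row degrees are at most `e` is minimal if the only polynomial vector of
degree less than `e` in its row space is zero. -/
theorem isMinimalBasis_of_rowSpan {P : Matrix (Fin p) (Fin q) F[X]}
    (hP : ∀ i j, (P i j).natDegree ≤ e) (hli : LinearIndependent (RatFunc F) (ratRow P))
    (h : ∀ v : Fin q → F[X], (fun j => algebraMap F[X] (RatFunc F) (v j)) ∈ rowSpan P →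
      (∀ j, (v j).degree < e) → v = 0) :
    IsMinimalBasis P := by
  refine ⟨hli, rfl, fun P' hli' hspan => Finset.sum_le_sum fun i _ => ?_⟩
  have hle : rowDeg P i ≤ e := Finset.sup_le fun j _ => hP i j
  refine hle.trans ?_
  by_contra hlt
  refine hli'.ne_zero i ?_
  have hz := h (P' i) (hspan ▸ Submodule.subset_span ⟨i, rfl⟩) fun j => by
    refine degree_le_natDegree.trans_lt ?_
    have : (P' i j).natDegree ≤ rowDeg P' i :=
      Finset.le_sup (f := fun j => (P' i j).natDegree) (Finset.mem_univ j)
    exact_mod_cast this.trans_lt (not_le.1 hlt)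
  funext j
  simp [ratRow, hz]

theorem ratMat_mulVec (P : Matrix (Fin p) (Fin q) F[X]) (v : Fin q → F[X]) (i : Fin p) :
    (ratMat P *ᵥ fun j => algebraMap F[X] (RatFunc F) (v j)) i =
      algebraMap F[X] (RatFunc F) ((P *ᵥ v) i) :=
  (RingHom.map_mulVec _ P v i).symm

theorem mem_rowSpan_iff (P : Matrix (Fin p) (Fin q) F[X]) (x : Fin q → RatFunc F) :
    x ∈ rowSpan P ↔ ∃ u, u ᵥ* ratMat P = x := by
  rw [rowSpan, Submodule.mem_span_range_iff_exists_fun]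
  simp only [vecMul_eq_sum]
  rfl

theorem linearIndependent_ratRow_iff (P : Matrix (Fin p) (Fin q) F[X]) :
    LinearIndependent (RatFunc F) (ratRow P) ↔
      ∀ u : Fin p → RatFunc F, u ᵥ* ratMat P = 0 → u = 0 := by
  rw [Fintype.linearIndependent_iff]
  simp only [vecMul_eq_sum, funext_iff (f := (_ : Fin p → RatFunc F))]
  rfl

/-- If `S_k(P)` has full row rank, a rational combination of the rows of `P` that is polynomial
of degree less than `e` is trivial. -/
theorem eq_zero_of_vecMul_ratMat_eq (he : 0 < e) (hk : 0 < k) {P : Matrix (Fin p) (Fin q) F[X]}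
    (hP : ∀ i j, (P i j).natDegree ≤ e) (hs : Function.Surjective (sylv e k P).mulVecLin)
    {u : Fin p → RatFunc F} {v : Fin q → F[X]} (hv : ∀ j, (v j).degree < e)
    (huv : u ᵥ* ratMat P = fun j => algebraMap F[X] (RatFunc F) (v j)) : u = 0 := by
  rw [sylv_mulVecLin_surjective_iff hP] at hs
  have key : ∀ (i : Fin p) (f : F[X]), f.degree < (k + e : ℕ) →
      ∃ x : Fin q → F[X], (∀ j, (x j).degree < k) ∧
        algebraMap F[X] (RatFunc F) (v ⬝ᵥ x) = u i * algebraMap F[X] (RatFunc F) f := by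
    intro i f hf
    obtain ⟨x, hx, hPx⟩ := hs (Pi.single i f) fun i' => by
      rcases eq_or_ne i' i with rfl | hne
      · simpa using hf
      · rw [Pi.single_eq_of_ne hne, degree_zero]
        exact WithBot.bot_lt_coe _
    refine ⟨x, hx, ?_⟩
    calc algebraMap F[X] (RatFunc F) (v ⬝ᵥ x)
        = (fun j => algebraMap F[X] (RatFunc F) (v j)) ⬝ᵥ
            fun j => algebraMap F[X] (RatFunc F) (x j) := by simp [dotProduct]
      _ = u ⬝ᵥ fun i => algebraMap F[X] (RatFunc F) ((P *ᵥ x) i) := by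
          rw [← huv, ← dotProduct_mulVec]
          congr 1
          funext i
          exact ratMat_mulVec P x i
      _ = u i * algebraMap F[X] (RatFunc F) f := by
          rw [hPx, dotProduct, Finset.sum_eq_single i]
          · simp
          · intro i' _ hne
            simp [hne]
          · simp
  funext i
  obtain ⟨x, -, hx⟩ := key i 1 (by
    rw [degree_one]
    exact_mod_cast (by omega : 0 < k + e))
  obtain ⟨y, hy, hxy⟩ := key i (X ^ (k + e - 1)) (by
    rw [degree_X_pow]
    exact_mod_cast (by omega : k + e - 1 < k + e))
  rw [map_one, mul_one] at hx
  rw [← hx, ← map_mul] at hxy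
  have hpoly := RatFunc.algebraMap_injective F hxy
  suffices v ⬝ᵥ x = 0 by rw [← hx, this, map_zero, Pi.zero_apply]
  have hlt : (v ⬝ᵥ y).degree < (k + e - 1 : ℕ) := by
    rw [← mem_degreeLT]
    refine Submodule.sum_mem _ fun j _ => mem_degreeLT.2 ?_
    by_cases hzero : v j * y j = 0
    · rw [hzero, degree_zero]
      exact WithBot.bot_lt_coe _
    · obtain ⟨hv0, hy0⟩ := mul_ne_zero_iff.1 hzero
      have h1 := (natDegree_lt_iff_degree_lt hv0).2 (hv j)
      have h2 := (natDegree_lt_iff_degree_lt hy0).2 (hy j)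
      rw [← natDegree_lt_iff_degree_lt hzero, natDegree_mul hv0 hy0]
      omega
  by_contra hne
  rw [hpoly, degree_mul, degree_X_pow, degree_eq_natDegree hne] at hlt
  have : (v ⬝ᵥ x).natDegree + (k + e - 1) < k + e - 1 := by exact_mod_cast hlt
  omega

/-- Surjectivity of a Sylvester matrix passes to all later ones. -/
theorem sylv_mulVecLin_surjective_mono {l : ℕ} (hk : 0 < k) (hkl : k ≤ l)
    {P : Matrix (Fin p) (Fin q) F[X]} (hP : ∀ i j, (P i j).natDegree ≤ e)
    (hs : Function.Surjective (sylv e k P).mulVecLin) :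
    Function.Surjective (sylv e l P).mulVecLin := by
  induction l, hkl using Nat.le_induction with
  | base => exact hs
  | succ l hkl ih =>
    rw [sylv_mulVecLin_surjective_iff hP] at ih ⊢
    intro w hw
    obtain ⟨v, hv, hPv⟩ := ih (fun i => divX (w i)) fun i => by
      rw [degree_lt_iff_coeff_zero]
      intro s hs
      rw [coeff_divX]
      exact (degree_lt_iff_coeff_zero _ _).1 (hw i) (s + 1) (by omega)
    obtain ⟨x, hx, hPx⟩ := ih (fun i => C ((w i).coeff 0)) fun i =>
      degree_C_le.trans_lt (by exact_mod_cast (by omega : 0 < l + e))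
    refine ⟨(X : F[X]) • v + x, fun j => ?_, ?_⟩
    · rw [degree_lt_iff_coeff_zero]
      intro s hs
      obtain ⟨s, rfl⟩ : ∃ t, s = t + 1 := ⟨s - 1, by omega⟩
      rw [Pi.add_apply, Pi.smul_apply, smul_eq_mul, coeff_add, coeff_X_mul,
        (degree_lt_iff_coeff_zero _ _).1 (hv j) s (by omega),
        (degree_lt_iff_coeff_zero _ _).1 (hx j) (s + 1) (by omega), add_zero]
    · rw [mulVec_add, mulVec_smul, hPv, hPx]
      funext i
      exact X_mul_divX_add (w i)

end FullSylvesterRank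

section Duality

variable {m n d e : ℕ}

theorem ratMat_mul_transpose {q : ℕ} {M : Matrix (Fin m) (Fin q) F[X]}
    {N : Matrix (Fin n) (Fin q) F[X]} (h : M * Nᵀ = 0) : ratMat M * (ratMat N)ᵀ = 0 := by
  have := congrArg (fun A => A.map (algebraMap F[X] (RatFunc F))) h
  simpa [ratMat, Matrix.map_mul, transpose_map] using this

theorem mul_transpose_eq_zero_symm {R : Type*} [CommRing R] {q : ℕ} {M : Matrix (Fin m) (Fin q) R}
    {N : Matrix (Fin n) (Fin q) R} (h : M * Nᵀ = 0) : N * Mᵀ = 0 := by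
  simpa using congrArg transpose h

theorem rowSpan_le_rightNullSpace {q : ℕ} {M : Matrix (Fin m) (Fin q) F[X]}
    {N : Matrix (Fin n) (Fin q) F[X]} (h : M * Nᵀ = 0) : rowSpan N ≤ rightNullSpace M := by
  intro x hx
  obtain ⟨u, rfl⟩ := (mem_rowSpan_iff N x).1 hx
  rw [rightNullSpace, LinearMap.mem_ker, mulVecLin_apply, ← mulVec_transpose, mulVec_mulVec,
    ratMat_mul_transpose h, zero_mulVec]

theorem rowSpan_eq_rightNullSpace {M : Matrix (Fin m) (Fin (m + n)) F[X]}
    {N : Matrix (Fin n) (Fin (m + n)) F[X]} (h : M * Nᵀ = 0)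
    (hM : LinearIndependent (RatFunc F) (ratRow M))
    (hN : LinearIndependent (RatFunc F) (ratRow N)) : rowSpan M = rightNullSpace N := by
  refine Submodule.eq_of_le_of_finrank_eq
    (rowSpan_le_rightNullSpace (mul_transpose_eq_zero_symm h)) ?_
  have h1 := LinearMap.finrank_range_add_finrank_ker (ratMat N).mulVecLin
  have h2 : (ratMat N).rank = n := by simpa using LinearIndependent.rank_matrix (M := ratMat N) hN
  rw [Module.finrank_fintype_fun_eq_card, Fintype.card_fin] at h1
  rw [Matrix.rank] at h2
  rw [rowSpan, finrank_span_eq_card hM, rightNullSpace, Fintype.card_fin]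
  omega

/-- If `M` has full-Sylvester-rank and `md = ne`, then `M` and any basis `N` of its right
null-space of degree at most `e` are minimal bases, and `N` has full-Sylvester-rank. -/
theorem isMinimalBasis_and_hasFullSylvesterRank_of_dual (hd : 0 < d) (he : 0 < e)
    (hde : m * d = n * e) {M : Matrix (Fin m) (Fin (m + n)) F[X]}
    (hdeg : ∀ i j, (M i j).natDegree ≤ d) (hfull : HasFullSylvesterRank d M)
    {N : Matrix (Fin n) (Fin (m + n)) F[X]} (hNdeg : ∀ i j, (N i j).natDegree ≤ e)
    (hN : LinearIndependent (RatFunc F) (ratRow N)) (hdual : M * Nᵀ = 0) :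
    IsMinimalBasis M ∧ IsMinimalBasis N ∧ HasFullSylvesterRank e N := by
  have hsq : (e + d) * m = e * (m + n) := by linarith
  have hsq' : (d + e) * n = d * (m + n) := by linarith
  have hrank := hfull e he
  have hinj : Function.Injective (sylv d e M).mulVecLin := by
    rw [← rank_eq_card_width_iff, hrank, hsq]
    simp
  have hsurj : Function.Surjective (sylv d e M).mulVecLin := by
    rw [← rank_eq_card_height_iff, hrank, ← hsq]
    simp
  have hM : LinearIndependent (RatFunc F) (ratRow M) := by
    rw [linearIndependent_ratRow_iff]
    intro u hu
    refine eq_zero_of_vecMul_ratMat_eq (v := 0) hd he hdeg hsurj (fun j => ?_) ?_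
    · rw [Pi.zero_apply, degree_zero]
      exact WithBot.bot_lt_coe _
    · rw [hu]
      funext j
      simp
  have hMlow : ∀ v : Fin (m + n) → F[X],
      (fun j => algebraMap F[X] (RatFunc F) (v j)) ∈ rowSpan M →
      (∀ j, (v j).degree < d) → v = 0 := by
    intro v hv hvd
    obtain ⟨u, hu⟩ := (mem_rowSpan_iff M _).1 hv
    have hu0 := eq_zero_of_vecMul_ratMat_eq hd he hdeg hsurj hvd hu
    funext j
    refine RatFunc.algebraMap_injective F ?_
    have := congrFun hu j
    rw [hu0, zero_vecMul] at this
    simpa using this.symm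
  have mulVec_eq_zero_iff : ∀ {r : ℕ} (P : Matrix (Fin r) (Fin (m + n)) F[X])
      (v : Fin (m + n) → F[X]),
      (fun j => algebraMap F[X] (RatFunc F) (v j)) ∈ rightNullSpace P ↔ P *ᵥ v = 0 := by
    intro r P v
    rw [rightNullSpace, LinearMap.mem_ker, mulVecLin_apply, funext_iff, funext_iff]
    refine forall_congr' fun i => ?_
    rw [ratMat_mulVec, Pi.zero_apply, Pi.zero_apply,
      map_eq_zero_iff _ (RatFunc.algebraMap_injective F)]
  have hNinj : ∀ v : Fin (m + n) → F[X], (∀ j, (v j).degree < d) → N *ᵥ v = 0 → v = 0 := by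
    intro v hv hNv
    refine hMlow v ?_ hv
    rw [rowSpan_eq_rightNullSpace hdual hM hN]
    exact (mulVec_eq_zero_iff N v).2 hNv
  refine ⟨isMinimalBasis_of_rowSpan hdeg hM hMlow, isMinimalBasis_of_rowSpan hNdeg hN ?_, ?_⟩
  · intro v hv hve
    exact (sylv_mulVecLin_injective_iff hdeg).1 hinj v hve
      ((mulVec_eq_zero_iff M v).1 (rowSpan_le_rightNullSpace hdual hv))
  · intro k hk
    rcases le_total k d with hkd | hkd
    · have hle : k * (m + n) ≤ (k + e) * n := by nlinarith
      rw [min_eq_right hle]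
      have h := (rank_eq_card_width_iff (sylv e k N)).2
        ((sylv_mulVecLin_injective_iff hNdeg).2 fun v hv hNv =>
          hNinj v (fun j => (hv j).trans_le (by exact_mod_cast hkd)) hNv)
      simpa using h
    · have hle : (k + e) * n ≤ k * (m + n) := by nlinarith
      rw [min_eq_left hle]
      have hdinj := (sylv_mulVecLin_injective_iff hNdeg).2 hNinj
      have hdsurj : Function.Surjective (sylv e d N).mulVecLin := by
        rw [← rank_eq_card_width_iff] at hdinj
        rw [← rank_eq_card_height_iff, hdinj]
        simp [hsq']
      have h := (rank_eq_card_height_iff (sylv e k N)).2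
        (sylv_mulVecLin_surjective_mono hd hkd hNdeg hdsurj)
      simpa using h

end Duality

section Reversal

variable {p q e : ℕ}

theorem natDegree_reflect_le_of_le {f : F[X]} (hf : f.natDegree ≤ e) :
    (f.reflect e).natDegree ≤ e := by
  rw [natDegree_le_iff_coeff_eq_zero]
  intro l hl
  rw [coeff_reflect, revAt_eq_self_of_lt hl]
  exact coeff_eq_zero_of_natDegree_lt (hf.trans_lt hl)

theorem reflect_sum {ι : Type*} (s : Finset ι) (f : ι → F[X]) :
    (∑ i ∈ s, f i).reflect e = ∑ i ∈ s, (f i).reflect e := by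
  ext l
  simp [coeff_reflect]

theorem revMat_mul_transpose {r d : ℕ} {M : Matrix (Fin p) (Fin q) F[X]}
    {N : Matrix (Fin r) (Fin q) F[X]} (hM : ∀ i j, (M i j).natDegree ≤ d)
    (hN : ∀ i j, (N i j).natDegree ≤ e) :
    revMat d M * (revMat e N)ᵀ = revMat (d + e) (M * Nᵀ) := by
  ext1 i j
  simp only [mul_apply, transpose_apply, revMat, reflect_sum]
  exact Finset.sum_congr rfl fun l _ => (reflect_mul _ _ (hM i l) (hN j l)).symm

theorem sylv_revMat (k : ℕ) {P : Matrix (Fin p) (Fin q) F[X]} :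
    sylv e k (revMat e P) = (sylv e k P).submatrix
      (Equiv.prodCongr Fin.revPerm (Equiv.refl _)) (Equiv.prodCongr Fin.revPerm (Equiv.refl _)) := by
  ext ⟨r, i⟩ ⟨c, j⟩
  simp only [sylv, submatrix_apply, Equiv.prodCongr_apply, Prod.map_apply, Fin.revPerm_apply,
    Fin.val_rev, Equiv.refl_apply, revMat]
  have hr := r.2
  have hc := c.2
  by_cases h : (c : ℕ) ≤ r ∧ (r : ℕ) ≤ c + e
  · rw [if_pos h, if_pos (by omega), coeff_reflect, revAt_le (by omega)]
    congr 1
    omega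
  · rw [if_neg h, if_neg (by omega)]

theorem HasFullSylvesterRank.revMat {P : Matrix (Fin p) (Fin q) F[X]}
    (h : HasFullSylvesterRank e P) : HasFullSylvesterRank e (revMat e P) := by
  intro k hk
  rw [sylv_revMat, rank_submatrix, h k hk]

theorem linearIndependent_ratRow_iff_polynomial (P : Matrix (Fin p) (Fin q) F[X]) :
    LinearIndependent (RatFunc F) (ratRow P) ↔ ∀ u : Fin p → F[X], u ᵥ* P = 0 → u = 0 := by
  rw [← LinearIndependent.iff_fractionRing (R := F[X]), Fintype.linearIndependent_iff]
  refine forall_congr' fun u => ?_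
  rw [funext_iff (f := u), funext_iff (f := u ᵥ* P), funext_iff]
  refine imp_congr (forall_congr' fun j => ?_) Iff.rfl
  rw [Pi.zero_apply, Pi.zero_apply, ← map_eq_zero_iff _ (RatFunc.algebraMap_injective F)]
  simp [vecMul, dotProduct, ratRow, Finset.sum_apply, Algebra.smul_def]

theorem linearIndependent_ratRow_revMat {P : Matrix (Fin p) (Fin q) F[X]}
    (hP : ∀ i j, (P i j).natDegree ≤ e) (h : LinearIndependent (RatFunc F) (ratRow P)) :
    LinearIndependent (RatFunc F) (ratRow (revMat e P)) := by
  rw [linearIndependent_ratRow_iff_polynomial] at h ⊢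
  intro u hu
  set D := Finset.univ.sup fun i => (u i).natDegree
  have hz := h (fun i => (u i).reflect D) (by
    funext j
    have hj := congrArg (reflect (D + e)) (congrFun hu j)
    rw [Pi.zero_apply, reflect_zero, vecMul, dotProduct, reflect_sum] at hj
    rw [Pi.zero_apply, ← hj, vecMul, dotProduct]
    refine Finset.sum_congr rfl fun i _ => ?_
    have hu : (u i).natDegree ≤ D :=
      Finset.le_sup (f := fun i => (u i).natDegree) (Finset.mem_univ i)
    have hmul := reflect_mul (u i) (revMat e P i j) hu (natDegree_reflect_le_of_le (hP i j))
    rw [hmul, revMat, reflect_reflect])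
  funext i
  simpa using congrFun hz i

end Reversal

/-- If `M(λ)` has full-Sylvester-rank, `N(λ)` is a minimal basis dual to `M(λ)` and
`t = nk' - md = 0`, then the reversals `rev_d M(λ) = λ^d M(1/λ)` and
`rev_{k'} N(λ) = λ^{k'} N(1/λ)` are dual minimal bases and both have
full-Sylvester-rank. -/
theorem reversal_dual_hasFullSylvesterRank {𝕜 : Type*} [RCLike 𝕜] {m n d : ℕ}
    (hm : 0 < m) (hn : 0 < n) (hd : 0 < d)
    (M : Matrix (Fin m) (Fin (m + n)) 𝕜[X]) (hdeg : ∀ i j, (M i j).natDegree ≤ d)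
    (hfull : HasFullSylvesterRank d M)
    (k' t : ℕ) (hk' : k' = ⌈(m * d : ℚ) / (n : ℚ)⌉₊) (ht : t = n * k' - m * d)
    (N : Matrix (Fin n) (Fin (m + n)) 𝕜[X]) (hNdeg : ∀ i j, (N i j).natDegree ≤ k')
    (hNmb : IsMinimalBasis N) (hdual : M * Nᵀ = 0)
    (ht0 : t = 0) :
    IsMinimalBasis (revMat d M) ∧ IsMinimalBasis (revMat k' N) ∧
    revMat d M * (revMat k' N)ᵀ = 0 ∧
    HasFullSylvesterRank d (revMat d M) ∧
    HasFullSylvesterRank k' (revMat k' N) := by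
  have hde : m * d = n * k' := by
    refine le_antisymm ?_ (by omega)
    have hnQ : (0 : ℚ) < n := by exact_mod_cast hn
    have h := Nat.le_ceil ((m * d : ℚ) / n)
    rw [← hk', div_le_iff₀ hnQ] at h
    rw [mul_comm n k']
    exact_mod_cast h
  have hk'pos : 0 < k' := Nat.pos_of_ne_zero fun h => by
    rw [h, mul_zero] at hde
    exact (Nat.mul_pos hm hd).ne' hde
  have hdual' : revMat d M * (revMat k' N)ᵀ = 0 := by
    rw [revMat_mul_transpose hdeg hNdeg, hdual]
    ext1 i j
    simp [revMat]
  obtain ⟨h1, h2, h3⟩ := isMinimalBasis_and_hasFullSylvesterRank_of_dual hd hk'pos hde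
    (fun i j => natDegree_reflect_le_of_le (hdeg i j)) hfull.revMat
    (fun i j => natDegree_reflect_le_of_le (hNdeg i j))
    (linearIndependent_ratRow_revMat hNdeg hNmb.1) hdual'
  exact ⟨h1, h2, hdual', hfull.revMat, h3⟩

end
end
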